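/- Let μ be a centered Gaussian measure on a separable Banach space X (i.e., a Borel probability measure such that the pushforward of μ under every continuous linear functional on X is a centered Gaussian distribution on ℝ). Then μ({ x ∈ X : ‖x‖ ≤ 1 }) > 0. -/

import Mathlib

open MeasureTheory ProbabilityTheory

/-- A centered Gaussian measure on a separable Banach space (a Borel probability
measure whose pushforward under every continuous linear functional is a centered
Gaussian distribution on `ℝ`) assigns positive measure to the closed unit ball. -/
theorem gaussian_measure_unit_ball_pos
    {X : Type*} [NormedAddCommGroup X] [NormedSpace ℝ X] [CompleteSpace X]
    [TopologicalSpace.SeparableSpace X]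
    [MeasurableSpace X] [BorelSpace X]
    (μ : Measure X) [IsProbabilityMeasure μ]
    (hGauss : ∀ ℓ : X →L[ℝ] ℝ, ∃ v : NNReal, μ.map ℓ = gaussianReal 0 v) :
    0 < μ {x : X | ‖x‖ ≤ 1} := by
  haveI : SecondCountableTopology X := UniformSpace.secondCountable_of_separable X
  haveI : IsGaussian μ := isGaussian_of_map_eq_gaussianReal fun L => ⟨0, hGauss L⟩
  have hmean : ∀ L : StrongDual ℝ X, ∫ x, L x ∂μ = 0 := by
    intro L
    obtain ⟨v, hv⟩ := hGauss L
    have h : ∫ y, y ∂(μ.map L) = ∫ x, L x ∂μ :=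
      integral_map (by fun_prop) (by fun_prop)
    rw [← h, hv, integral_id_gaussianReal]
  have hrot := IsGaussian.map_rotation_eq_self_of_forall_strongDual_eq_zero hmean (Real.pi / 4)
  -- a ball of radius 1/2 with positive measure
  obtain ⟨a, ha⟩ : ∃ a : X, 0 < μ (Metric.ball a (1 / 2)) := by
    by_contra! hcon
    have hz : μ Set.univ = 0 := by
      refine measure_null_of_locally_null _ fun x _ => ?_
      exact ⟨Metric.ball x (1 / 2), mem_nhdsWithin_of_mem_nhds
        (Metric.ball_mem_nhds x (by norm_num)), le_antisymm (hcon x) bot_le⟩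
    simp at hz
  have hmeas : MeasurableSet {x : X | ‖x‖ ≤ 1} :=
    (isClosed_le continuous_norm continuous_const).measurableSet
  have hpos : 0 < (μ.prod μ) (Metric.ball a (1 / 2) ×ˢ Metric.ball a (1 / 2)) := by
    rw [Measure.prod_prod]
    exact ENNReal.mul_pos ha.ne' ha.ne'
  have hfin : (μ.prod μ) (Set.univ ×ˢ {x : X | ‖x‖ ≤ 1}) = μ {x : X | ‖x‖ ≤ 1} := by
    rw [Measure.prod_prod, measure_univ, one_mul]
  rw [← hfin, ← hrot, Measure.map_apply (by fun_prop) (MeasurableSet.univ.prod hmeas)]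
  refine hpos.trans_le (measure_mono ?_)
  rintro ⟨x, y⟩ ⟨hx, hy⟩
  refine ⟨Set.mem_univ _, ?_⟩
  have hd : ‖y - x‖ ≤ 1 := by
    rw [← dist_eq_norm]
    have h1 := dist_triangle_right y x a
    have h2 : dist x a < 1 / 2 := hx
    have h3 : dist y a < 1 / 2 := hy
    linarith
  have hsc : Real.cos (Real.pi / 4) = Real.sin (Real.pi / 4) := by
    rw [Real.cos_pi_div_four, Real.sin_pi_div_four]
  have he : (ContinuousLinearMap.rotation (Real.pi / 4) (x, y)).2
      = Real.sin (Real.pi / 4) • (y - x) := by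
    simp only [ContinuousLinearMap.rotation_apply, hsc]
    module
  change ‖(ContinuousLinearMap.rotation (Real.pi / 4) (x, y)).2‖ ≤ 1
  rw [he, norm_smul, Real.norm_eq_abs]
  exact mul_le_one₀ (Real.abs_sin_le_one _) (norm_nonneg _) hd
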